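/- arXiv:math/0606689 — 2 statements merged into one kernel-verified Lean document; each statement's English description precedes it below -/
import Mathlib

section
/- Let A be a k-algebra and K a field extension of k such that K ⊗_k A satisfies MPC and the transcendence degree of K over k is at least 1. Then K ⊗_k A is an S-ring. -/
open Polynomial TensorProduct

/-- A ring satisfies MPC if its minimal primes are pairwise comaximal. -/
def MPC (A : Type*) [CommRing A] : Prop :=
  ∀ p ∈ minimalPrimes A, ∀ q ∈ minimalPrimes A, p ≠ q → p ⊔ q = ⊤

/-- A domain is an S-domain if every height-one prime `p` satisfies `ht (p[X]) = 1`. -/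
def IsSDomain (D : Type*) [CommRing D] [IsDomain D] : Prop :=
  ∀ p : PrimeSpectrum D, Order.height p = 1 →
    ∀ P : PrimeSpectrum D[X], P.asIdeal = p.asIdeal.map (C : D →+* D[X]) →
      Order.height P = 1

/-- A ring is a strong S-ring if the quotient by every prime is an S-domain. -/
def StrongSRing (A : Type*) [CommRing A] : Prop :=
  ∀ p : PrimeSpectrum A, IsSDomain (A ⧸ p.asIdeal)

/-- A ring is a stably strong S-ring if all polynomial rings over it in `n ≥ 1`
variables are strong S-rings. -/
def StablyStrongSRing (A : Type*) [CommRing A] : Prop :=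
  ∀ n : ℕ, 0 < n → StrongSRing (MvPolynomial (Fin n) A)

/-- A ring is locally finite dimensional (LFD) if every prime has finite height. -/
def LFD (A : Type*) [CommRing A] : Prop :=
  ∀ p : PrimeSpectrum A, Order.height p ≠ ⊤

/-- A ring is catenarian if it satisfies MPC, is LFD, and adjacent primes `P ⋖ Q`
satisfy `ht Q = ht P + 1`. -/
def Catenarian (A : Type*) [CommRing A] : Prop :=
  MPC A ∧ LFD A ∧
    ∀ P Q : PrimeSpectrum A, P ⋖ Q → Order.height Q = Order.height P + 1

/-- A ring is universally catenarian if all polynomial rings over it in `n ≥ 1`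
variables are catenarian. -/
def UniversallyCatenarian (A : Type*) [CommRing A] : Prop :=
  ∀ n : ℕ, 0 < n → Catenarian (MvPolynomial (Fin n) A)

/-- An S-ring: MPC together with the quotient by each minimal prime being an S-domain. -/
def SRing (A : Type*) [CommRing A] : Prop :=
  MPC A ∧ ∀ p : PrimeSpectrum A, p.asIdeal ∈ minimalPrimes A → IsSDomain (A ⧸ p.asIdeal)

/-- The transcendence degree of a `k`-algebra `A`: the supremum of the cardinalities
of algebraically independent subsets of `A` over `k`. -/
noncomputable def trdeg (k A : Type*) [CommRing k] [CommRing A] [Algebra k A] : Cardinal :=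
  ⨆ s : {s : Set A // AlgebraicIndependent k ((↑) : s → A)}, Cardinal.mk s.1

/-- If `D[σ]` has a nonzero prime inside `p[σ]` lying over `0`, then `D[X]` has a nonzero prime
strictly inside `p[X]`: a valuation ring of the residue field of the given prime that dominates
`D[σ]` at `p[σ]` contains a fraction of `D` whose residue is transcendental over `D ⧸ p`. -/
theorem exists_prime_lt_map_C_of_mvPolynomial {D σ : Type*} [CommRing D] [IsDomain D]
    (p : Ideal D) [p.IsPrime] (hp : p ≠ ⊥) (Q : Ideal (MvPolynomial σ D)) [Q.IsPrime]
    (hQ : Q ≠ ⊥) (hQD : Q.comap MvPolynomial.C = ⊥) (hQp : Q ≤ p.map MvPolynomial.C) :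
    ∃ Q₁ : Ideal D[X], Q₁.IsPrime ∧ Q₁ ≠ ⊥ ∧ Q₁ < p.map C := by
  classical
  let M := MvPolynomial σ D
  let P : Ideal M := p.map MvPolynomial.C
  have hPk : P = RingHom.ker (MvPolynomial.map (σ := σ) (Ideal.Quotient.mk p)) := by
    rw [MvPolynomial.ker_map, Ideal.mk_ker]
  have hP : P.IsPrime := hPk ▸ RingHom.ker_isPrime _
  let L := Q.ResidueField
  let g : M →+* L := algebraMap M L
  have hg : ∀ m, g m = 0 ↔ m ∈ Q := fun m ↦ by simp [g, L, Ideal.algebraMap_residueField_eq_zero]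
  let gl : Localization.AtPrime P →+* L := IsLocalization.lift (M := P.primeCompl) (g := g)
    fun y ↦ isUnit_iff_ne_zero.2 fun h ↦ y.2 (hQp ((hg _).1 h))
  obtain ⟨W, hW, hWl⟩ := IsLocalRing.exists_factor_valuationRing gl
  let gW : M →+* W := (gl.codRestrict W.toSubring hW).comp (algebraMap M (Localization.AtPrime P))
  have hgW : ∀ m, (gW m : L) = g m := fun m ↦ by simp [gW, gl]
  let κW := IsLocalRing.ResidueField W
  let r : M →+* κW := (IsLocalRing.residue W).comp gW
  have hr : ∀ m, r m = 0 ↔ m ∈ P := by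
    intro m
    have h1 : r m = 0 ↔ ¬ IsUnit (gW m) := by
      rw [← mem_nonunits_iff, ← IsLocalRing.mem_maximalIdeal]
      exact IsLocalRing.residue_eq_zero_iff _
    rw [h1, ← not_iff_not, not_not]
    change _ ↔ m ∈ P.primeCompl
    rw [← IsLocalization.AtPrime.isUnit_to_map_iff (Localization.AtPrime P) P]
    exact ⟨fun h ↦ hWl.map_nonunit _ h, fun h ↦ h.map (gl.codRestrict W.toSubring hW)⟩
  have hCP : ∀ d, MvPolynomial.C d ∈ P ↔ d ∈ p := fun d ↦ by
    rw [hPk, RingHom.mem_ker, MvPolynomial.map_C, MvPolynomial.C_eq_zero,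
      Ideal.Quotient.eq_zero_iff_mem]
  let rD : D ⧸ p →+* κW := Ideal.Quotient.lift p (r.comp MvPolynomial.C) fun a ha ↦
    (hr _).2 ((hCP _).2 ha)
  algebraize [rD]
  have hrD : Function.Injective (algebraMap (D ⧸ p) κW) :=
    RingHom.lift_injective_of_ker_le_ideal _ _ fun a ha ↦ (hCP _).1 ((hr _).1 ha)
  have : FaithfulSMul (D ⧸ p) κW := (faithfulSMul_iff_algebraMap_injective _ _).2 hrD
  let F := FractionRing D
  let gD : D →+* L := g.comp MvPolynomial.C
  have hgD : Function.Injective gD := (injective_iff_map_eq_zero _).2 fun a ha ↦ by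
    simpa [hQD] using (show a ∈ Q.comap MvPolynomial.C from (hg _).1 ha)
  let i : F →+* L := IsFractionRing.lift hgD
  have hi : ∀ d, i (algebraMap D F d) = gD d := fun d ↦ IsFractionRing.lift_algebraMap hgD d
  let V : Subring L := W.toSubring ⊓ i.fieldRange.toSubring
  let rV : V →+* κW := (IsLocalRing.residue W).comp (Subring.inclusion inf_le_left)
  have hVD : ∀ d, gD d ∈ V := fun d ↦ ⟨by
      change gD d ∈ W
      rw [show gD d = gW (MvPolynomial.C d) from (hgW _).symm]; exact Subtype.prop _,
      ⟨algebraMap D F d, hi d⟩⟩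
  let dV : D →+* V := gD.codRestrict V hVD
  have hrV : ∀ d, rV (dV d) = algebraMap (D ⧸ p) κW (Ideal.Quotient.mk p d) := fun d ↦ by
    change IsLocalRing.residue W _ = IsLocalRing.residue W (gW _)
    congr 1
    exact Subtype.ext (hgW _).symm
  by_cases hV : ∃ v : V, Transcendental (D ⧸ p) (rV v)
  · obtain ⟨v, hv⟩ := hV
    have hdV : Function.Injective dV := fun a b h ↦ hgD congr(($h : L))
    refine ⟨RingHom.ker (eval₂RingHom dV v), RingHom.ker_isPrime _, ?_, ?_, ?_⟩
    · obtain ⟨y, hy⟩ := v.2.2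
      obtain ⟨a, b, hb, rfl⟩ := IsFractionRing.div_surjective (A := D) y
      have hb0 := nonZeroDivisors.ne_zero hb
      refine fun h ↦ ?_
      have h2 : C b * X - C a ∈ RingHom.ker (eval₂RingHom dV v) := by
        simp only [RingHom.mem_ker, map_sub, map_mul, coe_eval₂RingHom, eval₂_C, eval₂_X]
        apply Subtype.ext
        change gD b * (v : L) - gD a = 0
        rw [← hy]
        have : gD b ≠ 0 := (map_ne_zero_iff _ hgD).2 hb0
        rw [map_div₀, hi, hi, mul_div_cancel₀ _ this, sub_self]
      rw [h, Ideal.mem_bot] at h2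
      have := congr(coeff $h2 1)
      simp [coeff_C] at this
      exact hb0 this
    · intro f hf
      rw [Ideal.mem_map_C_iff]
      have h0 : aeval (rV v) (f.map (Ideal.Quotient.mk p)) = 0 := by
        rw [aeval_def, eval₂_map]
        have := congr(rV $hf)
        rw [coe_eval₂RingHom, hom_eval₂, map_zero] at this
        convert this using 2
        ext d
        exact (hrV d).symm
      have := (transcendental_iff.1 hv) _ h0
      intro n
      rw [← Ideal.Quotient.eq_zero_iff_mem, ← coeff_map, this, coeff_zero]
    · intro h
      obtain ⟨a, ha, ha0⟩ := Submodule.exists_mem_ne_zero_of_ne_bot hp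
      have := h (Ideal.mem_map_of_mem C ha)
      rw [RingHom.mem_ker, coe_eval₂RingHom, eval₂_C] at this
      exact ha0 ((map_eq_zero_iff _ hdV).1 this)
  · exfalso
    push Not at hV
    let x : σ → κW := fun s ↦ r (MvPolynomial.X s)
    have hx : AlgebraicIndependent (D ⧸ p) x := by
      rw [algebraicIndependent_iff]
      intro f hf
      obtain ⟨f, rfl⟩ := MvPolynomial.map_surjective _ Ideal.Quotient.mk_surjective f
      rw [← RingHom.mem_ker, ← hPk, ← hr]
      rw [← hf, MvPolynomial.aeval_def, MvPolynomial.eval₂_map]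
      have := MvPolynomial.eval₂_comp_left r MvPolynomial.C MvPolynomial.X f
      rw [MvPolynomial.eval₂_eta] at this
      rw [this]
      rfl
    let A := Subalgebra.algebraicClosure (D ⧸ p) κW
    have hxA : AlgebraicIndependent A x := hx.subalgebraAlgebraicClosure
    let rA : V →+* A := rV.codRestrict A fun v ↦ not_not.1 (hV v)
    obtain ⟨f, hfQ, hf0⟩ := Submodule.exists_mem_ne_zero_of_ne_bot hQ
    obtain ⟨m, hm, hmax⟩ := f.support.exists_max_image (fun m ↦ W.valuation (gD (f.coeff m)))
      (by simpa [Finset.nonempty_iff_ne_empty] using hf0)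
    let c := gD (f.coeff m)
    have hc : c ≠ 0 := (map_ne_zero_iff _ hgD).2 (MvPolynomial.mem_support_iff.1 hm)
    have hcf : MvPolynomial.C c⁻¹ * f.map gD ∈ Set.range (MvPolynomial.map V.subtype) := by
      rw [MvPolynomial.mem_range_map_iff_coeffs_subset]
      rintro z hz
      obtain ⟨n, -, rfl⟩ := MvPolynomial.mem_coeffs_iff.1 hz
      rw [MvPolynomial.coeff_C_mul, MvPolynomial.coeff_map]
      have hmem : c⁻¹ * gD (f.coeff n) ∈ V := by
        refine ⟨(W.valuation_le_one_iff _).1 ?_, ⟨(algebraMap D F (f.coeff m))⁻¹ *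
          algebraMap D F (f.coeff n), by rw [map_mul, map_inv₀, hi, hi]⟩⟩
        rw [map_mul, map_inv₀, inv_mul_le_one₀ (by simpa [zero_lt_iff] using hc)]
        by_cases hn : n ∈ f.support
        · exact hmax n hn
        · simp [MvPolynomial.notMem_support_iff.1 hn]
      exact ⟨⟨_, hmem⟩, rfl⟩
    obtain ⟨h, hh⟩ := hcf
    have hhA : h.map rA = 0 := by
      apply hxA.eq_zero_of_aeval_eq_zero
      let j : V →+* W := Subring.inclusion inf_le_left
      have h0 : MvPolynomial.eval₂ j (fun s ↦ gW (MvPolynomial.X s)) h = 0 := by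
        apply Subtype.ext
        change W.subtype _ = 0
        rw [MvPolynomial.eval₂_comp_left]
        change MvPolynomial.eval₂ V.subtype _ h = 0
        rw [← MvPolynomial.eval_map, hh, map_mul, MvPolynomial.eval_map]
        have := MvPolynomial.eval₂_comp_left g MvPolynomial.C MvPolynomial.X f
        rw [MvPolynomial.eval₂_eta, (hg f).2 hfQ] at this
        rw [mul_eq_zero, this]
        right
        congr 1
        funext s
        exact hgW _
      have := congr(IsLocalRing.residue W $h0)
      rw [MvPolynomial.eval₂_comp_left, map_zero] at this
      rwa [MvPolynomial.aeval_def, MvPolynomial.eval₂_map]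
    have h1 : h.coeff m = 1 := by
      apply Subtype.ext
      have := congr(MvPolynomial.coeff m $hh)
      simpa [MvPolynomial.coeff_map, c, hc] using this
    have := congr(MvPolynomial.coeff m $hhA)
    simp [MvPolynomial.coeff_map, h1] at this

theorem Ideal.comap_C_map_C {R : Type*} [CommRing R] (I : Ideal R) :
    (I.map (C : R →+* R[X])).comap C = I := by
  ext a
  rw [Ideal.mem_comap, Ideal.mem_map_C_iff]
  refine ⟨fun h ↦ by simpa using h 0, fun h n ↦ ?_⟩
  rw [coeff_C]
  split_ifs
  exacts [h, I.zero_mem]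

theorem eq_map_C_of_comap_C_eq_bot {D : Type*} [CommRing D] [IsDomain D]
    (q : Ideal D[X]) [q.IsPrime] (hqD : q.comap C = ⊥)
    (Q : Ideal D[X][X]) [Q.IsPrime] (hQ : Q ≠ ⊥) (hQq : Q ≤ q.map C) : Q = q.map C := by
  by_contra hne
  let K := FractionRing D
  let _ := Polynomial.algebra D K
  let _ := Polynomial.algebra D[X] K[X]
  let M₁ : Submonoid D[X] := (nonZeroDivisors D).map C
  let M₂ : Submonoid D[X][X] := M₁.map C
  have i₁ : IsLocalization M₁ K[X] := Polynomial.isLocalization _ _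
  have i₂ : IsLocalization M₂ K[X][X] := Polynomial.isLocalization _ _
  have hqp : (q.map (C : D[X] →+* D[X][X])).IsPrime := Ideal.isPrime_map_C_of_isPrime
  have hd : Disjoint (M₂ : Set D[X][X]) (q.map C : Ideal D[X][X]) := by
    rw [Set.disjoint_left]
    rintro _ ⟨_, ⟨d, hd, rfl⟩, rfl⟩ h
    have : d ∈ (⊥ : Ideal D) := by
      rw [← hqD, Ideal.mem_comap, ← Ideal.comap_C_map_C q]
      exact h
    exact nonZeroDivisors.ne_zero hd this
  have hdQ : Disjoint (M₂ : Set D[X][X]) Q := hd.mono_right hQq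
  have h1 := IsLocalization.isPrime_of_isPrime_disjoint M₂ K[X][X] _ hqp hd
  have h2 := IsLocalization.isPrime_of_isPrime_disjoint M₂ K[X][X] Q inferInstance hdQ
  have e1 := IsLocalization.under_map_of_isPrime_disjoint M₂ K[X][X] hqp hd
  have e2 := IsLocalization.under_map_of_isPrime_disjoint M₂ K[X][X] (I := Q) inferInstance hdQ
  have hlt : Q.map (algebraMap D[X][X] K[X][X]) < (q.map C).map (algebraMap D[X][X] K[X][X]) := by
    refine lt_of_le_of_ne (Ideal.map_mono hQq) fun h ↦ hne ?_
    rw [← e1, ← e2, h]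
  have hinj : Function.Injective (algebraMap D[X][X] K[X][X]) :=
    map_injective _ (map_injective _ (IsFractionRing.injective D K))
  have hpos : ⊥ < Q.map (algebraMap D[X][X] K[X][X]) :=
    bot_lt_iff_ne_bot.2 fun h ↦ hQ ((Ideal.map_eq_bot_iff_of_injective hinj).1 h)
  have hmap : (q.map C).map (algebraMap D[X][X] K[X][X]) =
      (q.map (algebraMap D[X] K[X])).map C := by
    rw [Ideal.map_map, Ideal.map_map]
    congr 1
    exact RingHom.ext fun x ↦ map_C (algebraMap D[X] K[X])
  have hpr : ((q.map C).map (algebraMap D[X][X] K[X][X])).IsPrincipal := by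
    rw [hmap]; infer_instance
  have := Ideal.height_le_one_of_isPrincipal_of_mem_minimalPrimes
    ((q.map C).map (algebraMap D[X][X] K[X][X])) _
    (by rw [Ideal.minimalPrimes_eq_subsingleton_self]; rfl)
  have a1 := Ideal.height_add_one_le_of_lt_of_isPrime (R := K[X][X]) hlt
  have a2 := Ideal.height_add_one_le_of_lt_of_isPrime (R := K[X][X]) hpos
  have := (add_le_add_left a2 1).trans (a1.trans this)
  norm_num at this

/-- If `q` is a height-one prime of `D[X]`, then `q[Y]` is a height-one prime of `D[X][Y]`. -/
theorem eq_map_C_of_le {D : Type*} [CommRing D] [IsDomain D]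
    (q : Ideal D[X]) [q.IsPrime] (hmin : ∀ r : Ideal D[X], r.IsPrime → r < q → r = ⊥)
    (Q : Ideal D[X][X]) [Q.IsPrime] (hQ : Q ≠ ⊥) (hQq : Q ≤ q.map C) : Q = q.map C := by
  by_cases hqD : q.comap C = ⊥
  · exact eq_map_C_of_comap_C_eq_bot q hqD Q hQ hQq
  by_contra hne
  have hQD : Q.comap C = ⊥ := by
    refine hmin _ inferInstance (lt_of_le_of_ne ?_ fun h ↦ ?_)
    · exact (Ideal.comap_mono hQq).trans_eq (Ideal.comap_C_map_C q)
    · exact hne (hQq.antisymm (Ideal.map_le_iff_le_comap.2 h.ge))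
  have hq : (q.comap C).map C = q := by
    by_contra h
    have hp : ((q.comap C).map (C : D →+* D[X])).IsPrime := Ideal.isPrime_map_C_of_isPrime
    have := hmin _ hp (lt_of_le_of_ne Ideal.map_comap_le h)
    exact hqD ((Ideal.map_eq_bot_iff_of_injective C_injective).1 this)
  let e : MvPolynomial (Option Unit) D ≃ₐ[D] D[X][X] :=
    (MvPolynomial.optionEquivLeft D Unit).trans
      (Polynomial.mapAlgEquiv (MvPolynomial.uniqueAlgEquiv D Unit))
  have he : (e : MvPolynomial (Option Unit) D →+* D[X][X]).comp MvPolynomial.C = C.comp C := by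
    ext1 d
    exact e.commutes d
  obtain ⟨Q₁, hQ₁, h0, hlt⟩ := exists_prime_lt_map_C_of_mvPolynomial (q.comap C) hqD
    (Q.comap (e : MvPolynomial (Option Unit) D →+* D[X][X]))
    (fun h ↦ hQ (by
      rw [← Ideal.map_comap_of_surjective (e : MvPolynomial (Option Unit) D →+* D[X][X])
        e.surjective Q, h, Ideal.map_bot]))
    (by rw [Ideal.comap_comap, he, ← Ideal.comap_comap, hQD]
        exact (RingHom.injective_iff_ker_eq_bot _).1 C_injective)
    (by
      rw [← Ideal.comap_map_of_bijective (e : MvPolynomial (Option Unit) D →+* D[X][X])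
        e.bijective (I := Ideal.map _ _), Ideal.map_map, he, ← Ideal.map_map, hq]
      exact Ideal.comap_mono hQq)
  rw [hq] at hlt
  exact h0 (hmin _ hQ₁ hlt)

theorem PrimeSpectrum.height_eq_one_iff {D : Type*} [CommRing D] [IsDomain D]
    (p : PrimeSpectrum D) : Order.height p = 1 ↔
      p.asIdeal ≠ ⊥ ∧ ∀ r : Ideal D, r.IsPrime → r < p.asIdeal → r = ⊥ := by
  have h0 : ∀ q : PrimeSpectrum D, Order.height q = 0 ↔ q.asIdeal = ⊥ := fun q ↦ by
    rw [Order.height_eq_zero, isMin_iff_eq_bot, PrimeSpectrum.ext_iff]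
    rfl
  rw [le_antisymm_iff, and_comm]
  refine and_congr ?_ ?_
  · rw [Order.one_le_iff_ne_zero, Ne, h0]
  · rw [← Nat.cast_one, Order.height_le_coe_iff]
    simp only [Nat.cast_one, Order.lt_one_iff, h0]
    exact ⟨fun h r hr hlt ↦ h ⟨r, hr⟩ hlt, fun h q hlt ↦ h _ q.2 hlt⟩

theorem Ideal.comap_mapRingHom_map_C {R S : Type*} [CommRing R] [CommRing S] (φ : R →+* S)
    (I : Ideal S) : (I.map (C : S →+* S[X])).comap (mapRingHom φ) = (I.comap φ).map C := by
  ext f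
  simp [Ideal.mem_comap, Ideal.mem_map_C_iff, coeff_map]

theorem RingHom.Flat.exists_isPrime_le_comap_eq {B R : Type*} [CommRing B] [CommRing R]
    {f : B →+* R} (hf : f.Flat) (P : Ideal R) [P.IsPrime] (q : Ideal B) [q.IsPrime]
    (hq : q ≤ P.comap f) : ∃ P' ≤ P, P'.IsPrime ∧ P'.comap f = q := by
  algebraize [f]
  have : Module.Flat B R := hf
  have : P.LiesOver (P.comap f) := ⟨rfl⟩
  obtain ⟨P', hle, hP', hover⟩ := P.exists_ideal_le_liesOver_of_le (p := q) (q := P.comap f) hq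
  exact ⟨P', hle, hP', hover.over.symm⟩

theorem RingHom.Flat.comap_minimal {B R : Type*} [CommRing B] [CommRing R]
    {f : B →+* R} (hf : f.Flat) {P : Ideal R} (hP : P ∈ minimalPrimes R) {q : Ideal B}
    (hq : q.IsPrime) (hle : q ≤ P.comap f) : q = P.comap f := by
  have := hP.1.1
  obtain ⟨P', hP'le, hP', rfl⟩ := hf.exists_isPrime_le_comap_eq P q hle
  rw [hP'le.antisymm (hP.2 ⟨hP', bot_le⟩ hP'le)]

theorem Ideal.comap_map_eq_of_ker_le {R S : Type*} [CommRing R] [CommRing S] {φ : R →+* S}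
    (hφ : Function.Surjective φ) {I : Ideal R} (hI : RingHom.ker φ ≤ I) :
    (I.map φ).comap φ = I := by
  rw [Ideal.comap_map_of_surjective' φ hφ, sup_eq_left.2 hI]

theorem Ideal.comap_lt_comap_of_surjective {R S : Type*} [CommRing R] [CommRing S] {φ : R →+* S}
    (hφ : Function.Surjective φ) {I J : Ideal S} (h : I < J) : I.comap φ < J.comap φ :=
  lt_of_le_of_ne (Ideal.comap_mono h.le) fun e ↦
    h.ne (Ideal.comap_injective_of_surjective φ hφ e)

/-- A version of `eq_map_C_of_le` for rings with a surjection onto `D[X]`. -/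
theorem not_lt_map_C_of_map_C_ker_lt {B D : Type*} [CommRing B] [CommRing D] [IsDomain D]
    (π : B →+* D[X]) (hπ : Function.Surjective π) (q : Ideal B) [q.IsPrime]
    (hq : RingHom.ker π ≤ q)
    (hmin : ∀ r : Ideal B, r.IsPrime → RingHom.ker π ≤ r → r < q → r = RingHom.ker π)
    (Q : Ideal B[X]) [Q.IsPrime] (hQ : (RingHom.ker π).map C < Q) : ¬ Q < q.map C := by
  intro hQq
  have hqπ := Ideal.comap_map_eq_of_ker_le hπ hq
  have hqp : (q.map π).IsPrime := Ideal.map_isPrime_of_surjective hπ hq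
  have hqmin : ∀ r : Ideal D[X], r.IsPrime → r < q.map π → r = ⊥ := by
    intro r hr hlt
    have h1 := Ideal.comap_lt_comap_of_surjective hπ hlt
    rw [hqπ] at h1
    have h2 := hmin _ inferInstance (Ideal.ker_le_comap π) h1
    rw [RingHom.ker_eq_comap_bot] at h2
    exact Ideal.comap_injective_of_surjective π hπ h2
  have hρ : Function.Surjective (mapRingHom π) := map_surjective _ hπ
  have hρQ : RingHom.ker (mapRingHom π) ≤ Q := (ker_mapRingHom π).trans_le hQ.le
  have hQρ := Ideal.comap_map_eq_of_ker_le hρ hρQ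
  have hQp : (Q.map (mapRingHom π)).IsPrime := Ideal.map_isPrime_of_surjective hρ hρQ
  have h0 : Q.map (mapRingHom π) ≠ ⊥ := fun h ↦ hQ.ne (by
    rw [← hQρ, h, ← RingHom.ker_eq_comap_bot, ker_mapRingHom])
  have := eq_map_C_of_le (q.map π) hqmin (Q.map (mapRingHom π)) h0 (by
    rw [Ideal.map_le_iff_le_comap, Ideal.comap_mapRingHom_map_C, hqπ]
    exact hQq.le)
  rw [← hQρ, this, Ideal.comap_mapRingHom_map_C, hqπ] at hQq
  exact hQq.false

/-- Let `R` satisfy MPC and be flat over `A[X]`, with `R[Y]` integral over `A[X][Y]` up to units.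
If a prime `p` has height one over a minimal prime `P`, then so has `p[Y]` over `P[Y]`. -/
theorem not_lt_map_C_of_flat {A R : Type*} [CommRing A] [CommRing R] (f : A[X] →+* R)
    (hf : f.Flat)
    (hint : ∀ z : R[X], ∃ u : R[X], IsUnit u ∧ (mapRingHom f).IsIntegralElem (u * z))
    (hR : MPC R) (P : Ideal R) (hP : P ∈ minimalPrimes R) (p : Ideal R) [p.IsPrime] (hPp : P ≤ p)
    (hmin : ∀ r : Ideal R, r.IsPrime → P ≤ r → r < p → r = P)
    (Q : Ideal R[X]) [Q.IsPrime] (hPQ : P.map C < Q) : ¬ Q < p.map C := by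
  intro hQp
  have hPprime := hP.1.1
  have hC : (P.comap (f.comp C)).map C = P.comap f :=
    hf.comap_minimal hP Ideal.isPrime_map_C_of_isPrime (Ideal.map_le_iff_le_comap.2 le_rfl)
  have hlt : ∀ I J : Ideal R[X], I.IsPrime → I < J →
      I.comap (mapRingHom f) < J.comap (mapRingHom f) := by
    intro I J hI hIJ
    obtain ⟨hle, z, hzJ, hzI⟩ := SetLike.lt_iff_le_and_exists.1 hIJ
    obtain ⟨u, hu, huz⟩ := hint z
    let _ := (mapRingHom f).toAlgebra
    exact Ideal.comap_lt_comap_of_integral_mem_sdiff (R := A[X][X]) hle (x := u * z)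
      ⟨J.mul_mem_left _ hzJ, fun h ↦ (hI.mem_or_mem h).elim
        (fun h ↦ hI.ne_top (I.eq_top_of_isUnit_mem h hu)) hzI⟩ huz
  have hQ1 := hlt _ _ inferInstance hQp
  have hQ2 := hlt _ _ Ideal.isPrime_map_C_of_isPrime hPQ
  rw [Ideal.comap_mapRingHom_map_C] at hQ1 hQ2
  let π : A[X] →+* (A ⧸ P.comap (f.comp C))[X] := mapRingHom (Ideal.Quotient.mk _)
  have hπ : RingHom.ker π = P.comap f := by rw [ker_mapRingHom, Ideal.mk_ker, hC]
  refine not_lt_map_C_of_map_C_ker_lt π (map_surjective _ Ideal.Quotient.mk_surjective) (p.comap f)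
    (hπ.trans_le (Ideal.comap_mono hPp)) ?_ (Q.comap (mapRingHom f)) (hπ.symm ▸ hQ2) hQ1
  rw [hπ]
  intro r hr hPr hrp
  obtain ⟨P₁, hP₁le, hP₁, rfl⟩ := hf.exists_isPrime_le_comap_eq p r hrp.le
  obtain ⟨P₂, hP₂, hP₂le⟩ := Ideal.exists_minimalPrimes_le (I := ⊥) (J := P₁) bot_le
  have h2 : P₂ = P := by
    by_contra hne
    exact (inferInstance : p.IsPrime).ne_top
      (top_le_iff.1 (hR _ hP₂ _ hP hne ▸ sup_le (hP₂le.trans hP₁le) hPp))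
  rw [hmin P₁ hP₁ (h2 ▸ hP₂le) (lt_of_le_of_ne hP₁le (by rintro rfl; exact hrp.false))]

/-- A ring with MPC that is flat over some `A[X]`, and such that `R[Y]` is integral over `A[X][Y]`
up to units, is an S-ring. -/
theorem sRing_of_flat {A R : Type*} [CommRing A] [CommRing R] (f : A[X] →+* R) (hf : f.Flat)
    (hint : ∀ z : R[X], ∃ u : R[X], IsUnit u ∧ (mapRingHom f).IsIntegralElem (u * z))
    (hR : MPC R) : SRing R := by
  refine ⟨hR, fun P hP p hp P' hP' ↦ ?_⟩
  rw [PrimeSpectrum.height_eq_one_iff] at hp ⊢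
  obtain ⟨hp0, hpmin⟩ := hp
  rw [hP']
  refine ⟨fun h ↦ hp0 ((Ideal.map_eq_bot_iff_of_injective C_injective).1 h),
    fun Q hQ hQlt ↦ ?_⟩
  by_contra hQ0
  have hmk := Ideal.Quotient.mk_surjective (I := P.asIdeal)
  have hbot : (⊥ : Ideal (R ⧸ P.asIdeal)).comap (Ideal.Quotient.mk P.asIdeal) = P.asIdeal := by
    rw [← RingHom.ker_eq_comap_bot, Ideal.mk_ker]
  have hμ : Function.Surjective (mapRingHom (Ideal.Quotient.mk P.asIdeal)) := map_surjective _ hmk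
  have h1 := Ideal.comap_lt_comap_of_surjective hμ hQlt
  have h2 := Ideal.comap_lt_comap_of_surjective hμ (bot_lt_iff_ne_bot.2 hQ0)
  rw [Ideal.comap_mapRingHom_map_C] at h1
  rw [← Ideal.map_bot (f := C), Ideal.comap_mapRingHom_map_C, hbot] at h2
  refine not_lt_map_C_of_flat f hf hint hR P.asIdeal hP
    (p.asIdeal.comap (Ideal.Quotient.mk P.asIdeal)) (hbot.symm.trans_le (Ideal.comap_mono bot_le))
    (fun r hr hPr hrp ↦ ?_) _ h2 h1
  have hk : RingHom.ker (Ideal.Quotient.mk P.asIdeal) ≤ r := by rwa [Ideal.mk_ker]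
  have hr' := Ideal.comap_map_eq_of_ker_le hmk hk
  have := hpmin _ (Ideal.map_isPrime_of_surjective hmk hk)
    (lt_of_le_of_ne (Ideal.map_le_iff_le_comap.2 hrp.le) fun h ↦ hrp.ne (by rw [← h, hr']))
  rw [← hr', this, hbot]

/-- If `x` is a transcendence basis of `K` over `k`, then every element of `K` has a nonzero multiple
that is integral over `k[x]`. -/
theorem IsTranscendenceBasis.exists_isIntegralElem_aeval_mul {ι k K : Type*} [Field k] [Field K]
    [Algebra k K] {x : ι → K} (hx : IsTranscendenceBasis k x) (z : K) :
    ∃ o : MvPolynomial ι k, o ≠ 0 ∧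
      (MvPolynomial.aeval x : MvPolynomial ι k →ₐ[k] K).toRingHom.IsIntegralElem
        (MvPolynomial.aeval x o * z) := by
  algebraize [(MvPolynomial.aeval x : MvPolynomial ι k →ₐ[k] K).toRingHom]
  have := hx.isAlgebraic
  have hz : IsAlgebraic (MvPolynomial ι k) z :=
    (isAlgebraic_ringHom_iff_of_comp_eq hx.1.aevalEquiv (RingHom.id K) Function.injective_id
      (RingHom.ext fun p ↦ hx.1.algebraMap_aevalEquiv p)).1
      (Algebra.IsAlgebraic.isAlgebraic z)
  obtain ⟨o, ho, hint⟩ := hz.exists_integral_multiple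
  refine ⟨o, ho, ?_⟩
  rw [Algebra.smul_def] at hint
  exact hint

theorem AlgebraicIndependent.flat_aeval {ι k K : Type*} [Field k] [Field K] [Algebra k K]
    {x : ι → K} (hx : AlgebraicIndependent k x) :
    (MvPolynomial.aeval x : MvPolynomial ι k →ₐ[k] K).toRingHom.Flat := by
  let O := MvPolynomial ι k
  let g : FractionRing O →+* K := IsFractionRing.lift (A := O) (K := FractionRing O)
    (g := (MvPolynomial.aeval x : MvPolynomial ι k →ₐ[k] K).toRingHom) hx
  have hg : g.comp (algebraMap O (FractionRing O)) =
      (MvPolynomial.aeval x : MvPolynomial ι k →ₐ[k] K).toRingHom :=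
    RingHom.ext fun o ↦ IsFractionRing.lift_algebraMap (K := FractionRing O) hx o
  change RingHom.Flat (MvPolynomial.aeval x : MvPolynomial ι k →ₐ[k] K).toRingHom
  rw [← hg]
  exact .comp ((RingHom.flat_algebraMap_iff).2 (IsLocalization.flat _ (nonZeroDivisors O)))
    (.of_isField (Field.toIsField _) g)

/-- If every element of `K` becomes integral over a subring `O` after multiplication by a nonzero
element of `O`, then every element of `(K ⊗ A)[X]` becomes integral over `(O ⊗ A)[X]` after
multiplication by a unit. -/
theorem exists_isUnit_mul_isIntegralElem {k O K A B : Type*} [Field k] [Field K]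
    [Algebra k K] [CommRing O] [Nontrivial O] [NoZeroDivisors O] [Algebra k O] [CommRing A]
    [Algebra k A] [CommRing B] (a : O →ₐ[k] K) (ha : Function.Injective a)
    (halg : ∀ z, ∃ o, o ≠ 0 ∧ a.toRingHom.IsIntegralElem (a o * z)) (e : B ≃+* O ⊗[k] A)
    (z : (K ⊗[k] A)[X]) :
    ∃ u : (K ⊗[k] A)[X], IsUnit u ∧
      (mapRingHom ((Algebra.TensorProduct.map a (AlgHom.id k A)).toRingHom.comp
        (e : B →+* O ⊗[k] A))).IsIntegralElem (u * z) := by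
  let t := (Algebra.TensorProduct.map a (AlgHom.id k A)).toRingHom
  let f := t.comp (e : B →+* O ⊗[k] A)
  let δ : O →+* B[X] := (C.comp (e.symm : O ⊗[k] A →+* B)).comp
    (Algebra.TensorProduct.includeLeft : O →ₐ[k] O ⊗[k] A).toRingHom
  let γ : O →+* (K ⊗[k] A)[X] := (mapRingHom f).comp δ
  have hrange (w : O ⊗[k] A) : (mapRingHom f).IsIntegralElem (C (t w)) := by
    obtain ⟨b, rfl⟩ := e.surjective w
    have := (mapRingHom f).isIntegralElem_map (x := C b)
    rwa [coe_mapRingHom, map_C] at this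
  have hγ (o) : (mapRingHom f).IsIntegralElem (γ o) := (mapRingHom f).isIntegralElem_map
  have hγt (o) : γ o = C (a o ⊗ₜ 1) := by simp [γ, δ, f, t]
  have hunit (o) (ho : o ≠ 0) : IsUnit (γ o) := by
    rw [hγt]
    exact ((isUnit_iff_ne_zero.2 ((map_ne_zero_iff a ha).2 ho)).map
      (Algebra.TensorProduct.includeLeft : K →ₐ[k] K ⊗[k] A)).map C
  suffices ∃ o, o ≠ 0 ∧ (mapRingHom f).IsIntegralElem (γ o * z) by
    obtain ⟨o, ho, h⟩ := this
    exact ⟨γ o, hunit o ho, h⟩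
  have hadd {y z : (K ⊗[k] A)[X]} (hy : ∃ o, o ≠ 0 ∧ (mapRingHom f).IsIntegralElem (γ o * y))
      (hz : ∃ o, o ≠ 0 ∧ (mapRingHom f).IsIntegralElem (γ o * z)) :
      ∃ o, o ≠ 0 ∧ (mapRingHom f).IsIntegralElem (γ o * (y + z)) := by
    obtain ⟨o, ho, hoy⟩ := hy
    obtain ⟨o', ho', hoz⟩ := hz
    refine ⟨o * o', mul_ne_zero ho ho', ?_⟩
    rw [show γ (o * o') * (y + z) = γ o' * (γ o * y) + γ o * (γ o' * z) by rw [map_mul]; ring]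
    exact .add _ (.mul _ (hγ _) hoy) (.mul _ (hγ _) hoz)
  induction z using Polynomial.induction_on' with
  | add p q hp hq => exact hadd hp hq
  | monomial n r =>
    have hX : (mapRingHom f).IsIntegralElem (X ^ n) := by
      have := (mapRingHom f).isIntegralElem_map (x := X ^ n)
      rwa [coe_mapRingHom, Polynomial.map_pow, map_X] at this
    induction r with
    | zero => exact ⟨1, one_ne_zero, by simpa using RingHom.isIntegralElem_zero _⟩
    | add r s hr hs => rw [map_add]; exact hadd hr hs
    | tmul c d =>
      obtain ⟨o, ho, hoc⟩ := halg c
      refine ⟨o, ho, ?_⟩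
      have h1 : γ o * monomial n (c ⊗ₜ d) = C ((a o * c) ⊗ₜ 1) * C (t (1 ⊗ₜ d)) * X ^ n := by
        rw [hγt, ← C_mul_X_pow_eq_monomial, ← mul_assoc, ← C_mul, ← C_mul]
        simp [t]
      rw [h1]
      refine .mul _ (.mul _ ?_ (hrange _)) hX
      have h2 := hoc.map ((C : (K ⊗[k] A) →+* _).comp
        (Algebra.TensorProduct.includeLeft : K →ₐ[k] K ⊗[k] A).toRingHom)
      have h3 : γ = ((C : (K ⊗[k] A) →+* _).comp
        (Algebra.TensorProduct.includeLeft : K →ₐ[k] K ⊗[k] A).toRingHom).comp a.toRingHom :=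
        RingHom.ext hγt
      rw [← h3] at h2
      exact h2.of_comp

/-- If `K ⊗ₖ A` satisfies MPC and `t.d.(K : k) ≥ 1` (i.e. `K` is
transcendental over `k`), then `K ⊗ₖ A` is an S-ring. -/
theorem stmt12 {k K A : Type*} [Field k] [Field K] [Algebra k K] [CommRing A]
    [Nontrivial A] [Algebra k A] [Algebra.Transcendental k K]
    (h : MPC (K ⊗[k] A)) : SRing (K ⊗[k] A) := by
  classical
  obtain ⟨ι, x, hx⟩ := exists_isTranscendenceBasis' k K
  obtain ⟨i⟩ := hx.nonempty_iff_transcendental.2 inferInstance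
  let e : (MvPolynomial {j // j ≠ i} A)[X] ≃+* MvPolynomial ι k ⊗[k] A :=
    (((MvPolynomial.optionEquivLeft A {j // j ≠ i}).symm.trans
      (MvPolynomial.renameEquiv A (Equiv.optionSubtypeNe i))).toRingEquiv.trans
      (MvPolynomial.algebraTensorAlgEquiv k A).symm.toRingEquiv).trans
      (Algebra.TensorProduct.comm k A (MvPolynomial ι k)).toRingEquiv
  exact sRing_of_flat _ (.comp (.of_bijective e.bijective)
    (RingHom.Flat.tensorProductMap (R := k) (S := k) (g := AlgHom.id k A) hx.1.flat_aeval (.id _)))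
    (exists_isUnit_mul_isIntegralElem _ hx.1 hx.exists_isIntegralElem_aeval_mul e) h
end

section
/- Let A be a domain that is a k-algebra whose integral closure A' is a Prüfer domain, and let K be an algebraic field extension of k. Then K ⊗_k A is a stably strong S-ring. -/
open Polynomial TensorProduct

/-- A domain is Prüfer if every nonzero finitely generated ideal is invertible
as a fractional ideal. -/
def IsPruferDomain (A : Type*) [CommRing A] [IsDomain A] : Prop :=
  ∀ I : Ideal A, I.FG → I ≠ ⊥ →
    IsUnit (I : FractionalIdeal (nonZeroDivisors A) (FractionRing A))

/-- Over a Prüfer domain, every nonzero finite family has, locally at a prime `q`, a member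
dividing all the others. -/
theorem IsPruferDomain.exists_dvd_mul {V : Type*} [CommRing V] [IsDomain V]
    (h : IsPruferDomain V) (q : Ideal V) [q.IsPrime] (t : Finset V) (ht : ∃ c ∈ t, c ≠ 0) :
    ∃ c ∈ t, ∃ s ∉ q, ∀ d ∈ t, c ∣ s * d := by
  set I : Ideal V := Ideal.span (t : Set V)
  have hI0 : I ≠ ⊥ := by
    obtain ⟨c, hc, hc0⟩ := ht
    exact fun h0 ↦ hc0 (Ideal.mem_bot.1 (h0 ▸ Ideal.subset_span hc))
  obtain ⟨J, hJ⟩ := (h I ⟨t, rfl⟩ hI0).exists_right_inv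
  by_contra! hcon
  have hint : ∀ c ∈ I, ∀ u ∈ J,
      ∃ v, algebraMap V (FractionRing V) v = algebraMap V (FractionRing V) c * u := by
    intro c hc u hu
    have := FractionalIdeal.mul_mem_mul (FractionalIdeal.mem_coeIdeal_of_mem _ hc) hu
    rw [hJ] at this
    exact (FractionalIdeal.mem_one_iff _).1 this
  have hle : (I : FractionalIdeal (nonZeroDivisors V) (FractionRing V)) * J ≤
      (q : FractionalIdeal (nonZeroDivisors V) (FractionRing V)) := by
    rw [FractionalIdeal.mul_le]
    intro i hi u hu
    obtain ⟨c, hc, rfl⟩ := (FractionalIdeal.mem_coeIdeal _).1 hi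
    induction hc using Submodule.span_induction with
    | mem c hc =>
      obtain ⟨s, hs⟩ := hint c (Ideal.subset_span hc) u hu
      rw [FractionalIdeal.mem_coeIdeal]
      refine ⟨s, ?_, hs⟩
      by_contra hsq
      obtain ⟨d, hd, hnd⟩ := hcon c hc s hsq
      obtain ⟨v, hv⟩ := hint d (Ideal.subset_span hd) u hu
      refine hnd ⟨v, IsFractionRing.injective V (FractionRing V) ?_⟩
      simp only [map_mul, hs, hv]
      ring
    | zero => simp
    | add x y hx hy hx' hy' =>
      rw [map_add, add_mul]
      exact Submodule.add_mem _ (hx' (FractionalIdeal.mem_coeIdeal_of_mem _ hx))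
        (hy' (FractionalIdeal.mem_coeIdeal_of_mem _ hy))
    | smul a x hx hx' =>
      rw [smul_eq_mul, map_mul, mul_assoc, ← Algebra.smul_def]
      exact Submodule.smul_mem _ a (hx' (FractionalIdeal.mem_coeIdeal_of_mem _ hx))
  rw [hJ] at hle
  obtain ⟨x, hx, hx1⟩ := (FractionalIdeal.mem_coeIdeal _).1 (hle (FractionalIdeal.one_mem_one _))
  have : x = 1 := IsFractionRing.injective V (FractionRing V) (by simpa using hx1)
  exact (inferInstance : q.IsPrime).ne_top ((Ideal.eq_top_iff_one q).2 (this ▸ hx))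

theorem MvPolynomial.isPrime_map_C {σ A : Type*} [CommRing A] (q : Ideal A) [q.IsPrime] :
    (q.map (MvPolynomial.C : A →+* MvPolynomial σ A)).IsPrime := by
  have := RingHom.ker_isPrime (MvPolynomial.map (σ := σ) (Ideal.Quotient.mk q))
  rwa [MvPolynomial.ker_map, Ideal.mk_ker] at this

/-- Over a Prüfer domain, a prime of a polynomial ring contained in an extended prime contains the
coefficients of all its members. -/
theorem IsPruferDomain.C_coeff_mem {σ V : Type*} [CommRing V] [IsDomain V]
    (h : IsPruferDomain V) (q : Ideal V) [q.IsPrime] (U : Ideal (MvPolynomial σ V)) [U.IsPrime]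
    (hU : U ≤ q.map MvPolynomial.C) {F : MvPolynomial σ V} (hF : F ∈ U) (m : σ →₀ ℕ) :
    MvPolynomial.C (F.coeff m) ∈ U := by
  classical
  have hC {s : V} (hs : MvPolynomial.C s ∈ U) : s ∈ q := by
    simpa using MvPolynomial.mem_map_C_iff.1 (hU hs) 0
  by_contra hm
  have hm0 : F.coeff m ≠ 0 := fun h0 ↦ hm (by simp [h0])
  have hmem : ∀ m, F.coeff m ≠ 0 → F.coeff m ∈ F.support.image F.coeff := fun m hm ↦
    Finset.mem_image_of_mem _ (MvPolynomial.mem_support_iff.2 hm)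
  obtain ⟨c, hc, s, hs, hdvd⟩ := h.exists_dvd_mul q (F.support.image F.coeff)
    ⟨_, hmem m hm0, hm0⟩
  obtain ⟨i, hi, rfl⟩ := Finset.mem_image.1 hc
  have hsU : MvPolynomial.C s ∉ U := fun h ↦ hs (hC h)
  have hiU : MvPolynomial.C (F.coeff i) ∉ U := by
    intro hiU
    obtain ⟨v, hv⟩ := hdvd _ (hmem m hm0)
    have : MvPolynomial.C s * MvPolynomial.C (F.coeff m) ∈ U := by
      rw [← map_mul, hv, map_mul]
      exact U.mul_mem_right _ hiU
    exact ((inferInstance : U.IsPrime).mem_or_mem this).elim hsU hm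
  obtain ⟨G, hG⟩ := (MvPolynomial.C_dvd_iff_dvd_coeff (F.coeff i) (MvPolynomial.C s * F)).2 (by
    intro j
    rw [MvPolynomial.coeff_C_mul]
    by_cases hj : F.coeff j = 0
    · simp [hj]
    · exact hdvd _ (hmem j hj))
  have hGU : G ∈ U := ((inferInstance : U.IsPrime).mem_or_mem
    (hG ▸ U.mul_mem_left _ hF)).resolve_left hiU
  have hGi := MvPolynomial.mem_map_C_iff.1 (hU hGU) i
  have hcoeff := congrArg (MvPolynomial.coeff i) hG
  rw [MvPolynomial.coeff_C_mul, MvPolynomial.coeff_C_mul, mul_comm s] at hcoeff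
  exact hs (mul_left_cancel₀ (MvPolynomial.mem_support_iff.1 hi) hcoeff ▸ hGi)

attribute [local instance] MvPolynomial.algebraMvPolynomial in
/-- If a domain `A` has an integral extension which is a Prüfer domain, then a prime of a polynomial
ring over `A` contained in an extended prime is extended. -/
theorem IsPruferDomain.le_map_C_of_isIntegral {σ A V : Type*} [CommRing A] [CommRing V]
    [IsDomain V] [Algebra A V] [FaithfulSMul A V] [Algebra.IsIntegral A V]
    (h : IsPruferDomain V) (q : Ideal A) [q.IsPrime] (U : Ideal (MvPolynomial σ A)) [U.IsPrime]
    (hU : U ≤ q.map MvPolynomial.C) :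
    U ≤ (U.comap MvPolynomial.C).map MvPolynomial.C := by
  have hmap : algebraMap (MvPolynomial σ A) (MvPolynomial σ V) =
    MvPolynomial.map (algebraMap A V) := rfl
  have hinj : Function.Injective (algebraMap (MvPolynomial σ A) (MvPolynomial σ V)) :=
    MvPolynomial.map_injective _ (FaithfulSMul.algebraMap_injective A V)
  have hqp := MvPolynomial.isPrime_map_C (σ := σ) q
  obtain ⟨U', hU', hUU'⟩ := Ideal.exists_ideal_over_prime_of_isIntegral_of_isDomain
    (S := MvPolynomial σ V) U (by rw [(RingHom.injective_iff_ker_eq_bot _).1 hinj]; exact bot_le)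
  obtain ⟨Q', hUQ', hQ', hqQ'⟩ := Ideal.exists_ideal_over_prime_of_isIntegral_of_isPrime
    (S := MvPolynomial σ V) (q.map MvPolynomial.C) U' (hUU'.trans_le hU)
  have hpr := MvPolynomial.isPrime_map_C (σ := σ) (Q'.comap MvPolynomial.C)
  have hQext : Q' = (Q'.comap MvPolynomial.C).map MvPolynomial.C := by
    by_contra hne
    have hlt := Ideal.IsIntegral.comap_lt_comap (R := MvPolynomial σ A)
      (lt_of_le_of_ne Ideal.map_comap_le (Ne.symm hne))
    rw [hqQ'] at hlt
    refine hlt.not_ge (Ideal.map_le_iff_le_comap.2 fun a ha ↦ ?_)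
    have : MvPolynomial.C a ∈ Q'.comap (algebraMap (MvPolynomial σ A) (MvPolynomial σ V)) :=
      hqQ' ▸ Ideal.mem_map_of_mem _ ha
    simp only [Ideal.mem_comap, hmap, MvPolynomial.map_C] at this ⊢
    exact Ideal.mem_map_of_mem _ this
  intro F hF
  rw [MvPolynomial.mem_map_C_iff]
  intro m
  rw [← hUU'] at hF ⊢
  have := h.C_coeff_mem (Q'.comap MvPolynomial.C) U' (hUQ'.trans hQext.le) hF m
  simpa [hmap, MvPolynomial.coeff_map] using this

/-- A finitely generated algebra is quasi-finite at a prime which is comparable to no other prime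
of its fibre. -/
theorem Algebra.QuasiFiniteAt.of_forall_eq {R S : Type*} [CommRing R] [CommRing S] [Algebra R S]
    [Algebra.FiniteType R S] (Q : PrimeSpectrum S)
    (h : ∀ U : PrimeSpectrum S, U ≤ Q ∨ Q ≤ U →
      U.comap (algebraMap R S) = Q.comap (algebraMap R S) → U = Q) :
    Algebra.QuasiFiniteAt R Q.asIdeal := by
  refine .of_isOpen_singleton_fiber Q ?_
  set p := Q.comap (algebraMap R S)
  set x : PrimeSpectrum.comap (algebraMap R S) ⁻¹' {p} := ⟨Q, rfl⟩
  set e := PrimeSpectrum.preimageOrderIsoFiber R S p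
  have : IsNoetherianRing (p.asIdeal.Fiber S) :=
    Algebra.FiniteType.isNoetherianRing p.asIdeal.ResidueField _
  have : IsJacobsonRing (p.asIdeal.Fiber S) :=
    isJacobsonRing_of_finiteType (A := p.asIdeal.ResidueField)
  have hx : ∀ u : PrimeSpectrum (p.asIdeal.Fiber S),
      u ≤ e x ∨
        e x ≤ u →
      u = e x := by
    intro u hu
    rw [← e.symm_apply_le, ← e.le_symm_apply] at hu
    rw [← e.symm_apply_eq]
    exact Subtype.ext (h (e.symm u).1 hu (e.symm u).2)
  have hopen : IsOpen {e x} := by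
    refine ((PrimeSpectrum.isOpen_singleton_tfae_of_isNoetherian_of_isJacobsonRing _).out 0 2).2
      (And.intro ?_ ?_)
    · rw [PrimeSpectrum.isClosed_singleton_iff_isMaximal, ← PrimeSpectrum.isMax_iff]
      exact fun u hu ↦ (hx u (.inr hu)).le
    · rintro a b hab rfl
      exact hx b (.inl ((PrimeSpectrum.le_iff_specializes _ _).2 hab))
  convert hopen.preimage (PrimeSpectrum.preimageHomeomorphFiber R S p).continuous
  ext y
  exact e.injective.eq_iff.symm

/-- A transcendence basis of `D ⧸ Q` over the image of `A`, lifted to `D`: polynomial relations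
modulo `Q` have coefficients in `Q`, and every ideal properly containing `Q` contains a polynomial
outside `Q`. -/
theorem Ideal.exists_lift_isTranscendenceBasis.{u, v} (A : Type u) {D : Type v} [CommRing A]
    [CommRing D] [Algebra A D] (Q : Ideal D) [Q.IsPrime] :
    ∃ (ι : Type v) (y : ι → D),
      (∀ F : MvPolynomial ι A, MvPolynomial.aeval y F ∈ Q →
        F ∈ (Q.comap (algebraMap A D)).map MvPolynomial.C) ∧
      ∀ U : Ideal D, Q < U →
        ∃ F : MvPolynomial ι A, MvPolynomial.aeval y F ∈ U ∧ MvPolynomial.aeval y F ∉ Q := by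
  have : FaithfulSMul (A ⧸ Q.comap (algebraMap A D)) (D ⧸ Q) :=
    (faithfulSMul_iff_algebraMap_injective _ _).2 Ideal.algebraMap_quotient_injective
  obtain ⟨ι, x, hx⟩ := exists_isTranscendenceBasis' (A ⧸ Q.comap (algebraMap A D)) (D ⧸ Q)
  choose y hy using fun i ↦ Ideal.Quotient.mk_surjective (x i)
  have hmk (F : MvPolynomial ι A) : Ideal.Quotient.mk Q (MvPolynomial.aeval y F) =
      MvPolynomial.aeval x (MvPolynomial.map (Ideal.Quotient.mk (Q.comap (algebraMap A D))) F) := by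
    rw [MvPolynomial.aeval_def, MvPolynomial.aeval_def, MvPolynomial.hom_eval₂,
      MvPolynomial.eval₂_map]
    congr
    exact funext hy
  refine ⟨ι, y, fun F hF ↦ ?_, fun U hU ↦ ?_⟩
  · rw [← Ideal.Quotient.eq_zero_iff_mem, hmk] at hF
    have := hx.1.eq_zero_of_aeval_eq_zero _ hF
    rwa [← RingHom.mem_ker, MvPolynomial.ker_map, Ideal.mk_ker] at this
  · obtain ⟨u, hu, huQ⟩ := SetLike.exists_of_lt hU
    have := hx.isAlgebraic
    have hne := Ideal.comap_ne_bot_of_algebraic_mem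
      (R := Algebra.adjoin (A ⧸ Q.comap (algebraMap A D)) (Set.range x))
      (mt Ideal.Quotient.eq_zero_iff_mem.1 huQ) (Ideal.mem_map_of_mem (Ideal.Quotient.mk Q) hu)
      (Algebra.IsAlgebraic.isAlgebraic _)
    obtain ⟨⟨g, hg⟩, hgU, hg0⟩ := Submodule.exists_mem_ne_zero_of_ne_bot hne
    rw [Algebra.adjoin_range_eq_range_aeval] at hg
    obtain ⟨G, rfl⟩ := hg
    obtain ⟨F, rfl⟩ := MvPolynomial.map_surjective _ Ideal.Quotient.mk_surjective G
    refine ⟨F, ?_, ?_⟩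
    · rw [← Ideal.mem_quotient_iff_mem hU.le, hmk]
      exact hgU
    · rw [← Ideal.Quotient.eq_zero_iff_mem, hmk]
      exact fun h0 ↦ hg0 (Subtype.ext h0)

theorem IsIntegral.adjoin_of_isIntegral {A R D : Type*} [CommRing A] [CommRing R] [CommRing D]
    [Algebra A R] [Algebra A D] [Algebra R D] [IsScalarTower A R D] [Algebra.IsIntegral A R]
    {s : Set D} {z : D} (hz : IsIntegral (Algebra.adjoin R s) z) :
    IsIntegral (Algebra.adjoin A s) z := by
  have hle : ∀ w : Algebra.adjoin R s, (w : D) ∈ integralClosure (Algebra.adjoin A s) D := by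
    rintro ⟨w, hw⟩
    induction hw using Algebra.adjoin_induction with
    | mem w hw =>
      exact isIntegral_algebraMap (x := (⟨w, Algebra.subset_adjoin hw⟩ : Algebra.adjoin A s))
    | algebraMap r =>
      exact ((Algebra.IsIntegral.isIntegral (R := A) r).algebraMap (B := D)).tower_top
    | add x y _ _ hx hy => exact add_mem hx hy
    | mul x y _ _ hx hy => exact mul_mem hx hy
  have : IsIntegral (integralClosure (Algebra.adjoin A s) D) z :=
    hz.map_of_comp_eq ((algebraMap (Algebra.adjoin R s) D).codRestrict _ hle) (RingHom.id D) rfl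
  exact isIntegral_trans _ this

/-- Zariski's main theorem for a subalgebra `E` separating the prime `Q` from the larger ideals. -/
theorem Subalgebra.zariskisMainProperty {R D : Type*} [CommRing R] [CommRing D] [Algebra R D]
    [Algebra.FiniteType R D] (E : Subalgebra R D) (Q : Ideal D) [Q.IsPrime]
    (hmin : ∀ U : Ideal D, U.IsPrime → U ≤ Q →
      Q.comap (algebraMap R D) ≤ U.comap (algebraMap R D) → U = Q)
    (hE : ∀ U : Ideal D, Q < U → ∃ e ∈ E, e ∈ U ∧ e ∉ Q) :
    Algebra.ZariskisMainProperty E Q := by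
  have : Algebra.FiniteType E D := .of_restrictScalars_finiteType R _ _
  have : Algebra.QuasiFiniteAt E Q := by
    refine Algebra.QuasiFiniteAt.of_forall_eq (⟨Q, inferInstance⟩ : PrimeSpectrum D) ?_
    rintro ⟨U, hU⟩ hUQ hcomap
    have hmem {d : D} (hd : d ∈ E) : d ∈ U ↔ d ∈ Q :=
      SetLike.ext_iff.1 (congrArg PrimeSpectrum.asIdeal hcomap) ⟨d, hd⟩
    refine PrimeSpectrum.ext ?_
    obtain hUQ | hUQ := hUQ
    · exact hmin U hU hUQ fun a ha ↦ (hmem (E.algebraMap_mem a)).2 ha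
    · by_contra hne
      obtain ⟨e, he, heU, heQ⟩ := hE U (lt_of_le_of_ne hUQ (Ne.symm hne))
      exact heQ ((hmem he).1 heU)
  exact .of_finiteType Q

/-- If `Q` is minimal among the primes over `Q ∩ R` and the `y i` separate `Q` from the larger
ideals, then `D` is algebraic over `A[y]`. -/
theorem Algebra.IsAlgebraic.adjoin_of_forall_eq {A R D ι : Type*} [CommRing A] [CommRing R]
    [CommRing D] [IsDomain D] [Algebra A R] [Algebra A D] [Algebra R D] [IsScalarTower A R D]
    [Algebra.IsIntegral A R] [Algebra.FiniteType R D] (Q : Ideal D) [Q.IsPrime]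
    (hmin : ∀ U : Ideal D, U.IsPrime → U ≤ Q →
      Q.comap (algebraMap R D) ≤ U.comap (algebraMap R D) → U = Q)
    (y : ι → D) (hy : ∀ U : Ideal D, Q < U →
      ∃ F : MvPolynomial ι A, MvPolynomial.aeval y F ∈ U ∧ MvPolynomial.aeval y F ∉ Q) :
    Algebra.IsAlgebraic (Algebra.adjoin A (Set.range y)) D := by
  obtain ⟨r, hrQ, hr, hrx⟩ := Algebra.zariskisMainProperty_iff.1
    ((Algebra.adjoin R (Set.range y)).zariskisMainProperty Q hmin fun U hU ↦ by
      obtain ⟨F, hFU, hFQ⟩ := hy U hU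
      have : MvPolynomial.aeval y F ∈ Algebra.adjoin A (Set.range y) := by
        rw [Algebra.adjoin_range_eq_range_aeval]
        exact ⟨F, rfl⟩
      have hle : Algebra.adjoin A (Set.range y) ≤
          (Algebra.adjoin R (Set.range y)).restrictScalars A :=
        Algebra.adjoin_le Algebra.subset_adjoin
      exact ⟨_, hle this, hFU, hFQ⟩)
  refine ⟨fun x ↦ ?_⟩
  obtain ⟨m, hm⟩ := hrx x
  have hr0 : r ^ m ≠ 0 := pow_ne_zero _ fun h0 ↦ hrQ (h0 ▸ Q.zero_mem)
  exact .of_mul (mem_nonZeroDivisors_of_ne_zero hr0)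
    (IsIntegral.adjoin_of_isIntegral (hr.pow m)).isAlgebraic
    (IsIntegral.adjoin_of_isIntegral hm).isAlgebraic

theorem Polynomial.exists_map_aeval_mem_of_isAlgebraic {A D ι : Type*} [CommRing A] [CommRing D]
    [IsDomain D] [Algebra A D] (y : ι → D)
    [Algebra.IsAlgebraic (Algebra.adjoin A (Set.range y)) D] (T : Ideal D[X]) [T.IsPrime]
    (hT : T ≠ ⊥) :
    ∃ F : (MvPolynomial ι A)[X], F.map (MvPolynomial.aeval y).toRingHom ∈ T ∧
      F.map (MvPolynomial.aeval (R := A) y).toRingHom ≠ 0 := by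
  obtain ⟨f, hfT, hf0⟩ := Submodule.exists_mem_ne_zero_of_ne_bot hT
  have hmk (g : D[X]) : aeval (Ideal.Quotient.mk T X) g = Ideal.Quotient.mk T g := by
    rw [← Ideal.Quotient.mkₐ_eq_mk D, aeval_algHom_apply, aeval_X_left_apply]
  have hx : IsAlgebraic D (Ideal.Quotient.mk T X) :=
    ⟨f, hf0, by rwa [hmk, Ideal.Quotient.eq_zero_iff_mem]⟩
  obtain ⟨p, hp0, hp⟩ := hx.restrictScalars (Algebra.adjoin A (Set.range y))
  rw [← aeval_map_algebraMap D, hmk, Ideal.Quotient.eq_zero_iff_mem] at hp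
  obtain ⟨F, hF⟩ : ∃ F : (MvPolynomial ι A)[X], F.map (MvPolynomial.aeval y).toRingHom =
      p.map (algebraMap (Algebra.adjoin A (Set.range y)) D) := by
    refine (mem_map_range _).2 fun n ↦ ?_
    obtain ⟨G, hG⟩ := (Algebra.adjoin_range_eq_range_aeval A y).le (p.coeff n).2
    rw [coeff_map]
    exact ⟨G, hG⟩
  refine ⟨F, hF ▸ hp, hF ▸ ?_⟩
  rwa [Ne, Polynomial.map_eq_zero_iff (FaithfulSMul.algebraMap_injective _ _)]

theorem Polynomial.eq_bot_of_comap_C_eq_bot.{u, v} {A : Type u} {R D : Type v} [CommRing A]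
    [CommRing R] [CommRing D] [IsDomain D] [Algebra A R] [Algebra A D] [Algebra R D]
    [IsScalarTower A R D] [Algebra.IsIntegral A R] [Algebra.FiniteType R D]
    (hA : ∀ (σ : Type v) (q : Ideal A) (U : Ideal (MvPolynomial σ A)), q.IsPrime → U.IsPrime →
      U ≤ q.map MvPolynomial.C → U ≤ (U.comap MvPolynomial.C).map MvPolynomial.C)
    (Q : Ideal D) [Q.IsPrime] (hmin : ∀ U : Ideal D, U.IsPrime → U ≤ Q →
      Q.comap (algebraMap R D) ≤ U.comap (algebraMap R D) → U = Q)
    (T : Ideal D[X]) [T.IsPrime] (hTQ : T ≤ Q.map C) (hT : T.comap C = ⊥) : T = ⊥ := by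
  by_contra hT0
  obtain ⟨ι, y, hy, hyQ⟩ := Q.exists_lift_isTranscendenceBasis A
  have := Algebra.IsAlgebraic.adjoin_of_forall_eq Q hmin y hyQ
  obtain ⟨F, hFT, hF0⟩ := exists_map_aeval_mem_of_isAlgebraic (A := A) y T hT0
  let ψ : MvPolynomial (Option ι) A →+* D[X] := (mapRingHom (MvPolynomial.aeval y).toRingHom).comp
    (MvPolynomial.optionEquivLeft A ι).toRingEquiv.toRingHom
  have hψ (G) : ψ G = (MvPolynomial.optionEquivLeft A ι G).map (MvPolynomial.aeval y).toRingHom :=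
    rfl
  have hle : T.comap ψ ≤ (Q.comap (algebraMap A D)).map MvPolynomial.C := by
    intro G hG
    rw [MvPolynomial.mem_map_C_iff]
    intro m
    have h1 := Ideal.mem_map_C_iff.1 (hTQ hG) (m none)
    rw [hψ, coeff_map] at h1
    have h2 := MvPolynomial.mem_map_C_iff.1 (hy _ h1) m.some
    rwa [MvPolynomial.optionEquivLeft_coeff_some_coeff_none] at h2
  have hker : ((T.comap ψ).comap MvPolynomial.C).map MvPolynomial.C ≤ RingHom.ker ψ := by
    rw [Ideal.map_le_iff_le_comap]
    intro a ha
    have hCa : ψ (MvPolynomial.C a) = C (algebraMap A D a) := by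
      simp [hψ, MvPolynomial.optionEquivLeft_C]
    have h0 : algebraMap A D a ∈ T.comap C := by
      rw [Ideal.mem_comap, ← hCa]
      exact ha
    rw [hT, Ideal.mem_bot] at h0
    rw [Ideal.mem_comap, RingHom.mem_ker, hCa, h0, C_0]
  have hF : ψ ((MvPolynomial.optionEquivLeft A ι).symm F) =
      F.map (MvPolynomial.aeval y).toRingHom := by
    rw [hψ, AlgEquiv.apply_symm_apply]
  refine hF0 (hF ▸ hker (hA _ _ _ inferInstance inferInstance hle ?_))
  rw [Ideal.mem_comap, hF]
  exact hFT

/-- The localization of a finitely generated algebra at a prime lying over the kernel of the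
structure map is Noetherian. -/
theorem IsNoetherianRing.localization_atPrime_of_comap_le_ker {R D : Type*} [CommRing R]
    [CommRing D] [Algebra R D] [Algebra.FiniteType R D] (Q : Ideal D) [Q.IsPrime]
    (hQ : Q.comap (algebraMap R D) ≤ RingHom.ker (algebraMap R D)) :
    IsNoetherianRing (Localization.AtPrime Q) := by
  let f : (Q.comap (algebraMap R D)).ResidueField →+* Localization.AtPrime Q :=
    Ideal.ResidueField.lift _ (algebraMap R (Localization.AtPrime Q))
      (fun a ha ↦ by
        rw [RingHom.mem_ker, IsScalarTower.algebraMap_apply R D, RingHom.mem_ker.1 (hQ ha),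
          map_zero])
      (fun a ha ↦ by
        rw [Submonoid.mem_comap, IsScalarTower.algebraMap_apply R D]
        exact IsLocalization.map_units (Localization.AtPrime Q)
          (⟨algebraMap R D a, ha⟩ : Q.primeCompl))
  algebraize [f]
  have : IsScalarTower R (Q.comap (algebraMap R D)).ResidueField (Localization.AtPrime Q) :=
    .of_algebraMap_eq fun a ↦ (Ideal.ResidueField.lift_algebraMap _ _ _ _ a).symm
  have : Algebra.EssFiniteType D (Localization.AtPrime Q) := .of_isLocalization _ Q.primeCompl
  have : Algebra.EssFiniteType R (Localization.AtPrime Q) := .comp R D _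
  have : Algebra.EssFiniteType (Q.comap (algebraMap R D)).ResidueField (Localization.AtPrime Q) :=
    .of_comp R _ _
  exact Algebra.EssFiniteType.isNoetherianRing (Q.comap (algebraMap R D)).ResidueField _

attribute [local instance] Polynomial.algebra Polynomial.isLocalization in
theorem Polynomial.height_map_C_of_isNoetherianRing_localization {D : Type*} [CommRing D]
    (Q : Ideal D) [Q.IsPrime] [IsNoetherianRing (Localization.AtPrime Q)] :
    (Q.map (C : D →+* D[X])).height = Q.height := by
  have h1 := IsLocalization.height_map_of_disjoint (S := (Localization.AtPrime Q)[X])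
    (Q.primeCompl.map (C : D →+* D[X])) (Q.map (C : D →+* D[X])) (by
      rw [Set.disjoint_left]
      rintro _ ⟨s, hs, rfl⟩ hsQ
      have := Ideal.mem_map_C_iff.1 hsQ 0
      rw [coeff_C_zero] at this
      exact hs this)
  have h2 : ((Q.map (C : D →+* D[X])).map
      (algebraMap D[X] (Localization.AtPrime Q)[X])) =
      (IsLocalRing.maximalIdeal (Localization.AtPrime Q)).map C := by
    rw [← Localization.AtPrime.map_eq_maximalIdeal, Ideal.map_map, Ideal.map_map]
    congr 1
    ext a
    simp [Polynomial.algebraMap_def]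
  rw [← h1, h2, height_map_C, ← Localization.AtPrime.map_eq_maximalIdeal]
  exact IsLocalization.height_map_of_disjoint Q.primeCompl Q
    (Set.disjoint_left.2 fun a ha ↦ ha)

theorem Ideal.height_eq_one_iff {D : Type*} [CommRing D] [IsDomain D] {P : Ideal D} [P.IsPrime] :
    P.height = 1 ↔ P ≠ ⊥ ∧ ∀ U : Ideal D, U.IsPrime → U < P → U = ⊥ := by
  have h : P.height ≤ 1 ↔ ∀ U : Ideal D, U.IsPrime → U < P → U = ⊥ := by
    have := Ideal.height_le_iff (p := P) (n := 1)
    simpa only [Nat.cast_one, Order.lt_one_iff, Ideal.height_eq_zero_iff_eq_bot] using this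
  rw [← h, le_antisymm_iff, and_comm, Order.one_le_iff_ne_zero, Ne,
    Ideal.height_eq_zero_iff_eq_bot]

theorem Polynomial.height_map_C_eq_one.{u, v} {A : Type u} {R D : Type v} [CommRing A]
    [CommRing R] [CommRing D] [IsDomain D] [Algebra A R] [Algebra A D] [Algebra R D]
    [IsScalarTower A R D] [Algebra.IsIntegral A R] [Algebra.FiniteType R D]
    (hA : ∀ (σ : Type v) (q : Ideal A) (U : Ideal (MvPolynomial σ A)), q.IsPrime → U.IsPrime →
      U ≤ q.map MvPolynomial.C → U ≤ (U.comap MvPolynomial.C).map MvPolynomial.C)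
    (Q : Ideal D) [Q.IsPrime] (hQ : Q.height = 1) : (Q.map (C : D →+* D[X])).height = 1 := by
  by_cases hmin : ∀ U : Ideal D, U.IsPrime → U ≤ Q →
      Q.comap (algebraMap R D) ≤ U.comap (algebraMap R D) → U = Q
  · rw [Ideal.height_eq_one_iff] at hQ ⊢
    refine ⟨(Ideal.map_eq_bot_iff_of_injective C_injective).not.2 hQ.1, fun T hT hTQ ↦ ?_⟩
    refine eq_bot_of_comap_C_eq_bot hA Q hmin T hTQ.le (hQ.2 _ inferInstance ?_)
    refine lt_of_le_of_ne (fun a ha ↦ ?_) fun h ↦ ?_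
    · have := Ideal.mem_map_C_iff.1 (hTQ.le ha) 0
      rwa [coeff_C_zero] at this
    · exact hTQ.not_ge (Ideal.map_le_iff_le_comap.2 h.ge)
  · push Not at hmin
    obtain ⟨U, hU, hUQ, hle, hne⟩ := hmin
    rw [(Ideal.height_eq_one_iff.1 hQ).2 U hU (lt_of_le_of_ne hUQ hne)] at hle
    have := IsNoetherianRing.localization_atPrime_of_comap_le_ker Q hle
    rw [height_map_C_of_isNoetherianRing_localization, hQ]

/-- A ring integral over a domain which has an integral extension that is a Prüfer domain is a
stably strong S-ring. -/
theorem StablyStrongSRing.of_isIntegral {A R V : Type*} [CommRing A] [CommRing R] [CommRing V]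
    [IsDomain V] [Algebra A V] [FaithfulSMul A V] [Algebra.IsIntegral A V]
    (h : IsPruferDomain V) [Algebra A R] [Algebra.IsIntegral A R] : StablyStrongSRing R := by
  intro n _ p Q hQ P hP
  rw [← PrimeSpectrum.height_eq_orderHeight] at hQ ⊢
  rw [hP]
  exact Polynomial.height_map_C_eq_one (A := A) (R := R)
    (fun σ q U _ _ hU ↦ h.le_map_C_of_isIntegral q U hU) Q.asIdeal hQ

/-- If the integral closure of the domain `A` (in its fraction
field) is a Prüfer domain and `K/k` is an algebraic field extension, then
`K ⊗ₖ A` is a stably strong S-ring. -/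
theorem stmt17 {k K A : Type*} [Field k] [Field K] [Algebra k K]
    [Algebra.IsAlgebraic k K] [CommRing A] [IsDomain A] [Algebra k A]
    (h : IsPruferDomain (integralClosure A (FractionRing A))) :
    StablyStrongSRing (K ⊗[k] A) := by
  let _ : Algebra A (K ⊗[k] A) := Algebra.TensorProduct.rightAlgebra
  have : Algebra.IsIntegral A (K ⊗[k] A) := Algebra.IsPushout.isIntegral k A K _
  exact .of_isIntegral (A := A) h
end
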